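/- Let n ≥ 2 and let 1 ≤ s_1 < s_2 < … < s_k < n/2 be integers with gcd(s_1,…,s_k,n) = 1. Then the number of spanning trees τ(n) of the circulant graph C_n(s_1,…,s_k) is given by τ(n) = (−1)^{(n−1)(s_k−1)} · n · ∏_{p=1}^{s_k−1} (T_n(w_p) − 1)/(w_p − 1), where w_1,…,w_{s_k−1} are the complex roots, counted with multiplicity, of the degree s_k − 1 polynomial P(w) = ∑_{j=1}^{k} (T_{s_j}(w) − 1)/(w − 1). -/

import Mathlib

open Polynomial Complex Finset
open scoped Classical

/-- The circulant graph `C_n(s 0, …, s (k-1))` on vertex set `ZMod n`: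
`i` is adjacent to `i ± s j (mod n)` for each `j`. -/
def circulant (n : ℕ) {k : ℕ} (s : Fin k → ℕ) : SimpleGraph (ZMod n) :=
  SimpleGraph.circulantGraph {x : ZMod n | ∃ j : Fin k, x = (s j : ZMod n)}

/-- The odd-valency circulant graph `C_{2n}(s 0, …, s (k-1), n)` on vertex set `ZMod (2n)`:
`i` is adjacent to `i ± s j (mod 2n)` for each `j`, and to `i + n (mod 2n)`. -/
def circulantOdd (n : ℕ) {k : ℕ} (s : Fin k → ℕ) : SimpleGraph (ZMod (2 * n)) :=
  SimpleGraph.circulantGraph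
    ({x : ZMod (2 * n) | ∃ j : Fin k, x = (s j : ZMod (2 * n))} ∪ {(n : ZMod (2 * n))})

/-- The number of spanning trees of `G`: the number of subgraphs of `G` (on the same
vertex set) that are trees. -/
noncomputable def numSpanningTrees {V : Type*} (G : SimpleGraph V) : ℕ :=
  Set.ncard {H : SimpleGraph V | H ≤ G ∧ H.IsTree}

/-- The graph joining every vertex `v` to its parent `f v`. -/
def parentGraph {V : Type*} (f : V → V) : SimpleGraph V :=
  SimpleGraph.fromRel fun u v => f u = v

/-- `f` is the parent function of a tree rooted at `r`. -/
def IsParentFun {V : Type*} (r : V) (f : V → V) : Prop :=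
  f r = r ∧ ∀ v, ∃ m, f^[m] v = r

theorem parentGraph_adj {V : Type*} {f : V → V} {u v : V} :
    (parentGraph f).Adj u v ↔ u ≠ v ∧ (f u = v ∨ f v = u) :=
  SimpleGraph.fromRel_adj _ _ _

namespace IsParentFun

variable {V : Type*} {r : V} {f g : V → V}

/-- The number of steps needed to reach the root. -/
noncomputable def depth (hf : IsParentFun r f) (v : V) : ℕ := Nat.find (hf.2 v)

theorem depth_parent_lt (hf : IsParentFun r f) {v : V} (hv : v ≠ r) :
    hf.depth (f v) < hf.depth v := by
  have hs : f^[hf.depth v] v = r := Nat.find_spec (hf.2 v)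
  rcases hd : hf.depth v with _ | d
  · rw [hd] at hs
    exact absurd hs hv
  · rw [hd, Function.iterate_succ_apply] at hs
    exact Nat.lt_succ_of_le (Nat.find_min' (hf.2 (f v)) hs)

theorem apply_ne (hf : IsParentFun r f) {v : V} (hv : v ≠ r) : f v ≠ v := fun h => by
  have := hf.depth_parent_lt hv
  rw [h] at this
  exact lt_irrefl _ this

/-- A nonempty set closed under taking parents contains the root. -/
theorem root_of_closed (hf : IsParentFun r f) {p : V → Prop}
    (hp : ∀ v, p v → p (f v)) {v : V} (hv : p v) : p r := by
  obtain ⟨m, hm⟩ := hf.2 v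
  rw [← hm]
  exact Function.Iterate.rec p hv hp m

theorem connected (hf : IsParentFun r f) : (parentGraph f).Connected := by
  have hr : ∀ v, (parentGraph f).Reachable v r := by
    intro v
    induction hd : hf.depth v using Nat.strong_induction_on generalizing v with
    | _ d ih =>
      by_cases hv : v = r
      · rw [hv]
      · have hadj : (parentGraph f).Adj v (f v) :=
          parentGraph_adj.2 ⟨(hf.apply_ne hv).symm, Or.inl rfl⟩
        exact hadj.reachable.trans (ih _ (hd ▸ hf.depth_parent_lt hv) _ rfl)
  have : Nonempty V := ⟨r⟩
  exact ⟨fun u v => (hr u).trans (hr v).symm⟩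

theorem mem_edgeSet (hf : IsParentFun r f) {e : Sym2 V} (he : e ∈ (parentGraph f).edgeSet) :
    ∃ v, v ≠ r ∧ s(v, f v) = e := by
  induction e using Sym2.ind with
  | _ u v =>
    obtain ⟨hne, h | h⟩ := parentGraph_adj.1 ((SimpleGraph.mem_edgeSet _).1 he)
    · refine ⟨u, ?_, by rw [h]⟩
      rintro rfl
      exact hne (hf.1.symm.trans h)
    · refine ⟨v, ?_, by rw [h, Sym2.eq_swap]⟩
      rintro rfl
      exact hne (h.symm.trans hf.1)

theorem isTree [Finite V] (hf : IsParentFun r f) : (parentGraph f).IsTree := by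
  cases nonempty_fintype V
  rw [SimpleGraph.isTree_iff_connected_and_card]
  refine ⟨hf.connected, le_antisymm ?_ hf.connected.card_vert_le_card_edgeSet_add_one⟩
  have hsub : (parentGraph f).edgeSet ⊆ (fun v => s(v, f v)) '' {v | v ≠ r} := fun e he =>
    hf.mem_edgeSet he
  have h1 := (Set.ncard_le_ncard hsub (Set.toFinite _)).trans (Set.ncard_image_le (Set.toFinite _))
  have h2 : ({v | v ≠ r} : Set V).ncard + 1 = Nat.card V := by
    have := Set.ncard_add_ncard_compl ({r} : Set V)
    rw [Set.ncard_singleton, add_comm] at this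
    exact this
  rw [Nat.card_coe_set_eq]
  omega

theorem ext_of_parentGraph_eq (hf : IsParentFun r f) (hg : IsParentFun r g)
    (h : parentGraph f = parentGraph g) : f = g := by
  have key : ∀ {f g : V → V}, IsParentFun r f → IsParentFun r g →
      parentGraph f = parentGraph g → ∀ v, f v ≠ g v → f (g v) = v := by
    intro f g hf hg h v hv
    have hvr : v ≠ r := by
      rintro rfl
      exact hv (hf.1.trans hg.1.symm)
    have hadj : (parentGraph f).Adj v (g v) := by
      rw [h]
      exact parentGraph_adj.2 ⟨(hg.apply_ne hvr).symm, Or.inl rfl⟩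
    exact (parentGraph_adj.1 hadj).2.resolve_left hv
  by_contra hne
  obtain ⟨v, hv⟩ := Function.ne_iff.1 hne
  refine hf.root_of_closed (p := fun v => f v ≠ g v) (fun v hv => ?_) hv
    (hf.1.trans hg.1.symm)
  have h1 : g (f v) = v := key hg hf h.symm v (Ne.symm hv)
  rw [h1]
  intro h2
  have hvr : v ≠ r := by
    rintro rfl
    exact hv (hf.1.trans hg.1.symm)
  have hfv : f v ≠ r := by
    intro h3
    rw [h3, hf.1] at h2
    exact hvr h2.symm
  have := hf.depth_parent_lt hvr
  have h4 := hf.depth_parent_lt hfv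
  rw [h2] at h4
  exact lt_asymm this h4

end IsParentFun

theorem SimpleGraph.IsTree.exists_parentGraph_eq {V : Type*} [Finite V] {T : SimpleGraph V}
    (hT : T.IsTree) (r : V) :
    ∃ f, IsParentFun r f ∧ (∀ v, v ≠ r → T.Adj v (f v)) ∧ parentGraph f = T := by
  have hex : ∀ v, ∃ w, (v = r → w = r) ∧ (v ≠ r → T.Adj v w ∧ T.dist w r < T.dist v r) := by
    intro v
    by_cases hv : v = r
    · exact ⟨r, fun _ => rfl, fun h => absurd hv h⟩
    · obtain ⟨p, hp⟩ := hT.connected.exists_walk_length_eq_dist v r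
      cases p with
      | nil => exact absurd rfl hv
      | @cons _ w _ hadj q =>
        refine ⟨w, fun h => absurd h hv, fun _ => ⟨hadj, ?_⟩⟩
        rw [SimpleGraph.Walk.length_cons] at hp
        have := SimpleGraph.dist_le q
        omega
  choose f hf0 hf1 using hex
  have hf : IsParentFun r f := by
    refine ⟨hf0 r rfl, fun v => ?_⟩
    induction hd : T.dist v r using Nat.strong_induction_on generalizing v with
    | _ d ih =>
      by_cases hv : v = r
      · exact ⟨0, hv⟩
      · obtain ⟨m, hm⟩ := ih _ (hd ▸ (hf1 v hv).2) _ rfl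
        exact ⟨m + 1, hm⟩
  refine ⟨f, hf, fun v hv => (hf1 v hv).1, ?_⟩
  have hle : parentGraph f ≤ T := by
    intro u v huv
    rw [← SimpleGraph.mem_edgeSet] at huv ⊢
    obtain ⟨w, hw, he⟩ := hf.mem_edgeSet huv
    rw [← he]
    exact (hf1 w hw).1
  exact le_antisymm hle
    ((SimpleGraph.isTree_iff_minimal_connected.1 hT).2 hf.connected hle)

section MatrixTree

variable {V R : Type*} [Fintype V] [DecidableEq V] [CommRing R]

/-- The reduced Laplacian of the functional graph of `f`, with a unit row at the root `r`. -/
noncomputable def parentMatrix {V : Type*} [DecidableEq V] (R : Type*) [CommRing R] (r : V) (f : V → V) : Matrix V V R :=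
  Matrix.of fun v => if v = r then Pi.single r 1 else Pi.single v 1 - Pi.single (f v) 1

theorem IsParentFun.det_parentMatrix {r : V} {f : V → V} (hf : IsParentFun r f) :
    (parentMatrix R r f).det = 1 := by
  have hbt : (parentMatrix R r f).BlockTriangular (fun v => OrderDual.toDual (hf.depth v)) := by
    intro v w hvw
    have hvw : hf.depth v < hf.depth w := hvw
    have hne : w ≠ v := by
      rintro rfl
      exact lt_irrefl _ hvw
    by_cases hv : v = r
    · subst hv
      simp [parentMatrix, hne]
    · have hwf : w ≠ f v := by
        rintro rfl
        exact lt_asymm hvw (hf.depth_parent_lt hv)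
      simp [parentMatrix, hv, hne, hwf]
  rw [hbt.det]
  refine Finset.prod_eq_one fun a _ => ?_
  have hone : (parentMatrix R r f).toSquareBlock (fun v => OrderDual.toDual (hf.depth v)) a = 1 := by
    ext ⟨v, hv⟩ ⟨w, hw⟩
    simp only [Matrix.toSquareBlock, Matrix.toSquareBlockProp,
      Matrix.one_apply, Subtype.mk.injEq, eq_comm (a := v) (b := w)]
    by_cases hvr : v = r
    · subst hvr
      simp [parentMatrix, Pi.single_apply]
    · have hwf : w ≠ f v := by
        rintro rfl
        exact (hf.depth_parent_lt hvr).ne (OrderDual.toDual.injective (hw.trans hv.symm))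
      simp [parentMatrix, hvr, Pi.single_apply, hwf]
  rw [hone, Matrix.det_one]

theorem det_parentMatrix_eq_zero [IsDomain R] {r : V} {f : V → V}
    (hr : f r = r) (hf : ¬ IsParentFun r f) : (parentMatrix R r f).det = 0 := by
  have hex : ∃ v, ∀ m, f^[m] v ≠ r := by
    by_contra! h
    exact hf ⟨hr, h⟩
  obtain ⟨v₀, hv₀⟩ := hex
  have hstep : ∀ v, v ≠ r → ((∃ m, f^[m] (f v) = r) ↔ ∃ m, f^[m] v = r) := by
    intro v hv
    constructor
    · rintro ⟨m, hm⟩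
      exact ⟨m + 1, hm⟩
    · rintro ⟨_ | m, hm⟩
      · exact absurd hm hv
      · exact ⟨m, hm⟩
  rw [← Matrix.exists_mulVec_eq_zero_iff]
  refine ⟨fun v => if ∃ m, f^[m] v = r then 0 else 1, fun h => ?_, ?_⟩
  · have := congrFun h v₀
    simp [hv₀] at this
  · ext v
    by_cases hv : v = r
    · subst hv
      simp only [Matrix.mulVec, parentMatrix, Matrix.of_apply, if_true, single_dotProduct,
        Pi.zero_apply, one_mul]
      exact if_pos ⟨0, rfl⟩
    · simp only [Matrix.mulVec, parentMatrix, Matrix.of_apply, if_neg hv, sub_dotProduct,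
        single_dotProduct, Pi.zero_apply, one_mul, hstep v hv, sub_self]

/-- The matrix tree theorem. -/
theorem adjugate_lapMatrix_apply_self [IsDomain R] (G : SimpleGraph V) [DecidableRel G.Adj]
    (r : V) :
    (G.lapMatrix R).adjugate r r = numSpanningTrees G := by
  let S : V → Finset V := fun v => if v = r then {r} else G.neighborFinset v
  have hS : ∀ f : V → V, f ∈ Fintype.piFinset S ↔ f r = r ∧ ∀ v, v ≠ r → G.Adj v (f v) := by
    intro f
    rw [Fintype.mem_piFinset]
    constructor
    · intro h
      refine ⟨by simpa [S] using h r, fun v hv => by simpa [S, hv] using h v⟩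
    · rintro ⟨h, h'⟩ v
      by_cases hv : v = r
      · subst hv
        simp [S, h]
      · simpa [S, hv] using h' v hv
  have hrow : (G.lapMatrix R).updateRow r (Pi.single r 1) = fun v => ∑ w ∈ S v,
      if v = r then (Pi.single r 1 : V → R) else Pi.single v 1 - Pi.single w 1 := by
    ext v w
    by_cases hv : v = r
    · subst hv
      simp [S]
    · simp [S, hv, Matrix.updateRow_apply, SimpleGraph.lapMatrix, SimpleGraph.degMatrix,
        Matrix.diagonal_apply, Pi.single_apply, SimpleGraph.adjMatrix_apply, Finset.sum_apply,
        eq_comm (a := v) (b := w)]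
  have hdet : (G.lapMatrix R).adjugate r r =
      ∑ f ∈ Fintype.piFinset S, (parentMatrix R r f).det := by
    rw [Matrix.adjugate_apply, hrow]
    exact Matrix.detRowAlternating.toMultilinearMap.map_sum_finset _ S
  have hcount : numSpanningTrees G = #{f ∈ Fintype.piFinset S | IsParentFun r f} := by
    rw [numSpanningTrees, ← Set.ncard_coe_finset]
    have himg : {H : SimpleGraph V | H ≤ G ∧ H.IsTree} = parentGraph ''
        (({f ∈ Fintype.piFinset S | IsParentFun r f} : Finset (V → V)) : Set (V → V)) := by
      ext H
      simp only [Set.mem_ofPred_eq, Set.mem_image, Finset.mem_coe, Finset.mem_filter, hS]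
      constructor
      · rintro ⟨hle, hH⟩
        obtain ⟨f, hf, hadj, rfl⟩ := hH.exists_parentGraph_eq r
        exact ⟨f, ⟨⟨hf.1, fun v hv => hle (hadj v hv)⟩, hf⟩, rfl⟩
      · rintro ⟨f, ⟨⟨-, hadj⟩, hf⟩, rfl⟩
        refine ⟨fun u v huv => ?_, hf.isTree⟩
        rw [← SimpleGraph.mem_edgeSet] at huv ⊢
        obtain ⟨w, hw, he⟩ := hf.mem_edgeSet huv
        rw [← he]
        exact hadj w hw
    rw [himg]
    refine Set.InjOn.ncard_image fun f hf g hg h => ?_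
    exact (Finset.mem_filter.1 hf).2.ext_of_parentGraph_eq (Finset.mem_filter.1 hg).2 h
  rw [hdet, hcount, Finset.card_filter, Nat.cast_sum]
  refine Finset.sum_congr rfl fun f hf => ?_
  by_cases h : IsParentFun r f
  · simp [h, h.det_parentMatrix]
  · simp [h, det_parentMatrix_eq_zero ((hS f).1 hf).1 h]

end MatrixTree

theorem trace_adjugate_of_mul_eq_mul_diagonal {ι R : Type*} [Fintype ι] [DecidableEq ι]
    [CommRing R] [IsDomain R] {M F : Matrix ι ι R} {d : ι → R}
    (hM : M * F = F * Matrix.diagonal d) (hF : F.det ≠ 0) :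
    M.adjugate.trace = ∑ i, ∏ j ∈ univ.erase i, d j := by
  have h := congrArg Matrix.adjugate hM
  rw [Matrix.adjugate_mul_distrib, Matrix.adjugate_mul_distrib, Matrix.adjugate_diagonal] at h
  have h' : (F * (F.adjugate * M.adjugate)).trace =
      (F * (Matrix.diagonal (fun i => ∏ j ∈ univ.erase i, d j) * F.adjugate)).trace := by rw [h]
  rw [← mul_assoc, Matrix.mul_adjugate, smul_mul_assoc, one_mul, Matrix.trace_smul,
    Matrix.trace_mul_comm F, mul_assoc, Matrix.adjugate_mul, mul_smul_comm, mul_one,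
    Matrix.trace_smul, Matrix.trace_diagonal] at h'
  exact mul_left_cancel₀ hF h'

theorem Polynomial.Chebyshev.T_eval_half_add {z w : ℂ} (h : z * w = 1) (m : ℕ) :
    (Polynomial.Chebyshev.T ℂ m).eval ((z + w) / 2) = (z ^ m + w ^ m) / 2 := by
  induction m using Nat.twoStepInduction with
  | zero => simp
  | one => simp
  | more m ih1 ih2 =>
    push_cast at ih1 ih2 ⊢
    rw [Polynomial.Chebyshev.T_add_two]
    simp only [eval_sub, eval_mul, eval_X, ih1, ih2, eval_ofNat]
    linear_combination (z ^ m + w ^ m) / 2 * h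

section Characters

variable {n : ℕ} [NeZero n]

theorem prod_X_sub_stdAddChar :
    ∏ m : ZMod n, (X - C (ZMod.stdAddChar m : ℂ)) = X ^ n - 1 := by
  have hprim := Complex.isPrimitiveRoot_exp n (NeZero.ne n)
  have himg : univ.image (ZMod.stdAddChar : ZMod n → ℂ) = nthRootsFinset n (1 : ℂ) := by
    refine eq_of_subset_of_card_le (fun x hx => ?_) ?_
    · obtain ⟨m, -, rfl⟩ := mem_image.1 hx
      rw [mem_nthRootsFinset (NeZero.pos n), ← AddChar.map_nsmul_eq_pow]
      simp
    · rw [card_image_of_injective _ ZMod.injective_stdAddChar, hprim.card_nthRootsFinset]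
      simp
  rw [X_pow_sub_one_eq_prod (NeZero.pos n) hprim, ← himg,
    prod_image ZMod.injective_stdAddChar.injOn]

theorem prod_sub_stdAddChar (z : ℂ) : ∏ m : ZMod n, (z - ZMod.stdAddChar m) = z ^ n - 1 := by
  simpa [eval_prod] using congrArg (eval z) (prod_X_sub_stdAddChar (n := n))

theorem prod_sub_stdAddChar_neg (z : ℂ) :
    ∏ m : ZMod n, (z - ZMod.stdAddChar (-m)) = z ^ n - 1 := by
  rw [← prod_sub_stdAddChar]
  exact Equiv.prod_comp (Equiv.neg (ZMod n)) fun m => z - (ZMod.stdAddChar m : ℂ)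

theorem prod_erase_one_sub_stdAddChar :
    ∏ m ∈ univ.erase (0 : ZMod n), (1 - (ZMod.stdAddChar m : ℂ)) = n := by
  have h := prod_X_sub_stdAddChar (n := n)
  rw [← mul_prod_erase _ _ (mem_univ (0 : ZMod n)), AddChar.map_zero_eq_one, C_1,
    ← mul_geom_sum] at h
  simpa [eval_prod, eval_geom_sum] using
    congrArg (eval 1) (mul_left_cancel₀ (Polynomial.X_sub_C_ne_zero (1 : ℂ)) h)

theorem prod_erase_one_sub_stdAddChar_neg :
    ∏ m ∈ univ.erase (0 : ZMod n), (1 - (ZMod.stdAddChar (-m) : ℂ)) = n := by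
  rw [← prod_erase_one_sub_stdAddChar]
  exact prod_equiv (Equiv.neg (ZMod n)) (by simp) (by simp)

/-- The cosine of `2 * π * m / n`. -/
noncomputable def zmodCos (m : ZMod n) : ℂ :=
  (ZMod.stdAddChar m + ZMod.stdAddChar (-m)) / 2

theorem stdAddChar_mul_neg (m : ZMod n) :
    (ZMod.stdAddChar m : ℂ) * ZMod.stdAddChar (-m) = 1 := by
  rw [← AddChar.map_add_eq_mul, add_neg_cancel, AddChar.map_zero_eq_one]

theorem zmodCos_zero : zmodCos (0 : ZMod n) = 1 := by
  simp [zmodCos]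

theorem T_eval_zmodCos (m : ZMod n) (a : ℕ) :
    (Polynomial.Chebyshev.T ℂ a).eval (zmodCos m) =
      (ZMod.stdAddChar (m * (a : ZMod n)) + ZMod.stdAddChar (-(m * (a : ZMod n)))) / 2 := by
  rw [zmodCos, Polynomial.Chebyshev.T_eval_half_add (stdAddChar_mul_neg m),
    ← AddChar.map_nsmul_eq_pow, ← AddChar.map_nsmul_eq_pow, nsmul_eq_mul, nsmul_eq_mul,
    mul_neg, mul_comm]

theorem prod_two_sub_zmodCos :
    ∏ m ∈ univ.erase (0 : ZMod n), (2 - 2 * zmodCos m) = (n : ℂ) ^ 2 := by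
  rw [sq]
  nth_rewrite 1 [← prod_erase_one_sub_stdAddChar]
  rw [← prod_erase_one_sub_stdAddChar_neg, ← prod_mul_distrib]
  refine prod_congr rfl fun m _ => ?_
  rw [zmodCos]
  linear_combination - stdAddChar_mul_neg m

theorem two_pow_mul_prod_sub_zmodCos (x : ℂ) :
    2 ^ n * ∏ m : ZMod n, (x - zmodCos m) =
      2 * ((Polynomial.Chebyshev.T ℂ n).eval x - 1) := by
  obtain ⟨y, hy⟩ := IsAlgClosed.exists_pow_nat_eq (x ^ 2 - 1) two_pos
  obtain ⟨z, w, hzw, rfl⟩ : ∃ z w : ℂ, z * w = 1 ∧ (z + w) / 2 = x :=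
    ⟨x + y, x - y, by linear_combination - hy, by ring⟩
  have hfac : ∀ m : ZMod n, 2 * ((z + w) / 2 - zmodCos m) =
      (z - ZMod.stdAddChar m) * (w * (z - ZMod.stdAddChar (-m))) := by
    intro m
    rw [zmodCos]
    linear_combination (ZMod.stdAddChar m + ZMod.stdAddChar (-m) - z : ℂ) * hzw - w * stdAddChar_mul_neg m
  have hcard : (2 : ℂ) ^ n = ∏ _m : ZMod n, 2 := by simp
  rw [hcard, ← prod_mul_distrib, prod_congr rfl fun m _ => hfac m, prod_mul_distrib,
    prod_mul_distrib, prod_sub_stdAddChar, prod_sub_stdAddChar_neg,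
    Polynomial.Chebyshev.T_eval_half_add hzw, prod_const, card_univ, ZMod.card]
  have hn : z ^ n * w ^ n = 1 := by rw [← mul_pow, hzw, one_pow]
  linear_combination (z ^ n - 2) * hn

theorem prod_erase_zmodCos_sub {x : ℂ} (hx : x ≠ 1) :
    2 ^ (n - 1) * ∏ m ∈ univ.erase (0 : ZMod n), (zmodCos m - x) =
      (-1) ^ (n - 1) * (((Polynomial.Chebyshev.T ℂ n).eval x - 1) / (x - 1)) := by
  have hx' : x - 1 ≠ 0 := sub_ne_zero.2 hx
  have h := two_pow_mul_prod_sub_zmodCos (n := n) x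
  rw [← mul_prod_erase _ _ (mem_univ (0 : ZMod n)), zmodCos_zero] at h
  have hneg : ∏ m ∈ univ.erase (0 : ZMod n), (zmodCos m - x) =
      (-1) ^ (n - 1) * ∏ m ∈ univ.erase (0 : ZMod n), (x - zmodCos m) := by
    have hcard : (-1 : ℂ) ^ (n - 1) = ∏ _m ∈ univ.erase (0 : ZMod n), (-1) := by
      simp [card_erase_of_mem]
    rw [hcard, ← prod_mul_distrib]
    exact prod_congr rfl fun m _ => by ring
  have h2 : (2 : ℂ) ^ n = 2 * 2 ^ (n - 1) := by rw [← pow_succ', Nat.sub_add_cancel (NeZero.pos n)]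
  rw [h2] at h
  rw [hneg]
  rw [mul_div_assoc', eq_div_iff hx']
  linear_combination (-1) ^ (n - 1) / 2 * h

theorem det_stdAddChar_ne_zero :
    (Matrix.of fun v m : ZMod n => (ZMod.stdAddChar (v * m) : ℂ)).det ≠ 0 := by
  intro h
  have hmul : (Matrix.of fun v m : ZMod n => (ZMod.stdAddChar (v * m) : ℂ)) *
      (Matrix.of fun m v : ZMod n => (ZMod.stdAddChar (-(m * v)) : ℂ)) = (n : ℂ) • 1 := by
    ext u v
    simp only [Matrix.mul_apply, Matrix.of_apply, ← AddChar.map_add_eq_mul]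
    have : ∀ x : ZMod n, u * x + -(x * v) = x * (u - v) := fun x => by ring
    simp only [this]
    rw [AddChar.sum_mulShift _ (ZMod.isPrimitive_stdAddChar n)]
    simp [Matrix.one_apply, sub_eq_zero]
  have := congrArg Matrix.det hmul
  rw [Matrix.det_mul, h, zero_mul, Matrix.det_smul, Matrix.det_one, mul_one] at this
  exact pow_ne_zero _ (Nat.cast_ne_zero.2 (NeZero.ne n)) this.symm

end Characters

section Circulant

variable {n k : ℕ} [NeZero n] {s : Fin k → ℕ}

theorem sum_neighborFinset_circulant {M : Type*} [AddCommMonoid M]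
    [DecidableRel (circulant n s).Adj] (hs : Function.Injective s) (h1 : ∀ j, 1 ≤ s j)
    (h2 : ∀ j, 2 * s j < n) (v : ZMod n) (g : ZMod n → M) :
    ∑ u ∈ (circulant n s).neighborFinset v, g u =
      ∑ j, (g (v + (s j : ZMod n)) + g (v - (s j : ZMod n))) := by
  have hval : ∀ {a b : ℕ}, a < n → b < n → (a : ZMod n) = (b : ZMod n) → a = b := by
    intro a b ha hb h
    rwa [ZMod.natCast_eq_natCast_iff', Nat.mod_eq_of_lt ha, Nat.mod_eq_of_lt hb] at h
  have hsum : ∀ i j, (s i : ZMod n) + (s j : ZMod n) ≠ 0 := by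
    intro i j h
    have := h1 i
    have := h2 i
    have := h2 j
    have := hval (a := s i + s j) (b := 0) (by omega) (by omega) (by simpa using h)
    omega
  have hpos : ∀ j, (s j : ZMod n) ≠ 0 := fun j h => by
    have := h1 j
    have := h2 j
    have := hval (a := s j) (b := 0) (by omega) (by omega) (by simpa using h)
    omega
  let e : Fin k ⊕ Fin k → ZMod n :=
    Sum.elim (fun j => v + (s j : ZMod n)) (fun j => v - (s j : ZMod n))
  have heq : ∀ i j, (s i : ZMod n) = (s j : ZMod n) → i = j := fun i j h => by
    have := h2 i
    have := h2 j
    exact hs (hval (by omega) (by omega) h)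
  have he : Function.Injective e := by
    rintro (i | i) (j | j) h
    · exact congrArg Sum.inl (heq i j (add_left_cancel h))
    · refine absurd ?_ (hsum i j)
      have h : v + (s i : ZMod n) = v - (s j : ZMod n) := h
      linear_combination h
    · refine absurd ?_ (hsum i j)
      have h : v - (s i : ZMod n) = v + (s j : ZMod n) := h
      linear_combination - h
    · exact congrArg Sum.inr (heq i j (sub_right_injective h))
  have himg : (circulant n s).neighborFinset v = univ.image e := by
    ext u
    rw [SimpleGraph.mem_neighborFinset]
    simp only [circulant, SimpleGraph.circulantGraph_adj,
      Set.mem_ofPred_eq, mem_image, mem_univ, true_and, Sum.exists, e, Sum.elim_inl, Sum.elim_inr]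
    constructor
    · rintro ⟨-, ⟨j, hj⟩ | ⟨j, hj⟩⟩
      · exact Or.inr ⟨j, by rw [← hj]; ring⟩
      · exact Or.inl ⟨j, by rw [← hj]; ring⟩
    · rintro (⟨j, rfl⟩ | ⟨j, rfl⟩)
      · exact ⟨by simpa using hpos j, Or.inr ⟨j, by ring⟩⟩
      · exact ⟨fun h => hpos j (by linear_combination h), Or.inl ⟨j, by ring⟩⟩
  rw [himg, sum_image he.injOn, Fintype.sum_sum_type, ← sum_add_distrib]
  rfl

/-- The Laplacian eigenvalues of a circulant graph. -/
noncomputable def circulantEigenvalue (s : Fin k → ℕ) (m : ZMod n) : ℂ :=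
  -2 * (∑ j, (Polynomial.Chebyshev.T ℂ (s j) - 1)).eval (zmodCos m)

theorem lapMatrix_circulant_mul_stdAddChar [DecidableRel (circulant n s).Adj]
    (hs : Function.Injective s) (h1 : ∀ j, 1 ≤ s j) (h2 : ∀ j, 2 * s j < n) :
    (circulant n s).lapMatrix ℂ * (Matrix.of fun v m : ZMod n => (ZMod.stdAddChar (v * m) : ℂ)) =
      (Matrix.of fun v m : ZMod n => (ZMod.stdAddChar (v * m) : ℂ)) *
        Matrix.diagonal (circulantEigenvalue s) := by
  ext v m
  rw [Matrix.mul_diagonal]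
  change ((circulant n s).lapMatrix ℂ).mulVec (fun u => (ZMod.stdAddChar (u * m) : ℂ)) v =
    ZMod.stdAddChar (v * m) * circulantEigenvalue s m
  rw [SimpleGraph.lapMatrix_mulVec_apply, ← SimpleGraph.card_neighborFinset_eq_degree,
    ← nsmul_eq_mul, ← sum_const, ← sum_sub_distrib, sum_neighborFinset_circulant hs h1 h2,
    circulantEigenvalue, eval_finsetSum, mul_sum, mul_sum]
  refine sum_congr rfl fun j _ => ?_
  rw [eval_sub, eval_one, T_eval_zmodCos, add_mul, sub_mul, AddChar.map_add_eq_mul,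
    sub_eq_add_neg (v * m), AddChar.map_add_eq_mul, mul_comm (s j : ZMod n) m]
  ring

theorem mul_numSpanningTrees_circulant (hs : Function.Injective s) (h1 : ∀ j, 1 ≤ s j)
    (h2 : ∀ j, 2 * s j < n) :
    (n : ℂ) * numSpanningTrees (circulant n s) =
      ∏ m ∈ univ.erase (0 : ZMod n), circulantEigenvalue s m := by
  have htr := trace_adjugate_of_mul_eq_mul_diagonal
    (lapMatrix_circulant_mul_stdAddChar hs h1 h2) det_stdAddChar_ne_zero
  have h0 : circulantEigenvalue s (0 : ZMod n) = 0 := by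
    simp [circulantEigenvalue, zmodCos_zero, eval_finsetSum]
  rw [sum_eq_single_of_mem 0 (mem_univ _) fun i _ hi =>
    prod_eq_zero (mem_erase.2 ⟨hi.symm, mem_univ _⟩) h0] at htr
  rw [← htr]
  simp [Matrix.trace, adjugate_lapMatrix_apply_self]

end Circulant

section ChebyshevSum

variable {k : ℕ} {s : Fin k → ℕ}

theorem X_sub_one_mul_divByMonic_sum_T_sub_one (s : Fin k → ℕ) :
    (X - C 1) * ((∑ j, (Polynomial.Chebyshev.T ℂ (s j) - 1)) /ₘ (X - C 1)) =
      ∑ j, (Polynomial.Chebyshev.T ℂ (s j) - 1) := by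
  rw [mul_divByMonic_eq_iff_isRoot]
  simp [IsRoot, eval_finsetSum]

theorem eval_one_divByMonic_sum_T_sub_one (s : Fin k → ℕ) :
    ((∑ j, (Polynomial.Chebyshev.T ℂ (s j) - 1)) /ₘ (X - C 1)).eval 1 =
      ∑ j, (s j : ℂ) ^ 2 := by
  have h := congrArg (fun p => (derivative p).eval 1) (X_sub_one_mul_divByMonic_sum_T_sub_one s)
  simpa [derivative_mul, eval_finsetSum, Polynomial.Chebyshev.derivative_T_eval_one] using h

theorem eval_one_divByMonic_sum_T_sub_one_ne_zero (hk : 0 < k) (h1 : ∀ j, 1 ≤ s j) :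
    ((∑ j, (Polynomial.Chebyshev.T ℂ (s j) - 1)) /ₘ (X - C 1)).eval 1 ≠ 0 := by
  rw [eval_one_divByMonic_sum_T_sub_one]
  have hpos : 0 < ∑ j, s j ^ 2 :=
    sum_pos (fun j _ => pow_pos (h1 j) 2) ⟨⟨0, hk⟩, mem_univ _⟩
  exact_mod_cast hpos.ne'

theorem natDegree_and_leadingCoeff_sum_T_sub_one (hmono : StrictMono s) (h1 : ∀ j, 1 ≤ s j) {l : Fin k}
    (hl : ∀ j, j ≤ l) :
    (∑ j, (Polynomial.Chebyshev.T ℂ (s j) - 1)).natDegree = s l ∧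
      (∑ j, (Polynomial.Chebyshev.T ℂ (s j) - 1)).leadingCoeff = 2 ^ (s l - 1) := by
  have hrest : (∑ j ∈ univ.erase l, Polynomial.Chebyshev.T ℂ (s j) - (k : ℂ[X])).degree <
      (Polynomial.Chebyshev.T ℂ (s l)).degree := by
    rw [Polynomial.Chebyshev.degree_T, Int.natAbs_natCast]
    refine (degree_sub_le _ _).trans_lt (max_lt ?_ ?_)
    · refine (degree_sum_le _ _).trans_lt ((Finset.sup_lt_iff (WithBot.bot_lt_coe _)).2 ?_)
      intro j hj
      rw [Polynomial.Chebyshev.degree_T, Int.natAbs_natCast]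
      exact_mod_cast hmono (lt_of_le_of_ne (hl j) (ne_of_mem_erase hj))
    · refine (degree_natCast_le k).trans_lt ?_
      exact_mod_cast h1 l
  have hsplit : ∑ j, (Polynomial.Chebyshev.T ℂ (s j) - 1) =
      Polynomial.Chebyshev.T ℂ (s l) +
        (∑ j ∈ univ.erase l, Polynomial.Chebyshev.T ℂ (s j) - (k : ℂ[X])) := by
    rw [sum_sub_distrib, ← add_sum_erase _ _ (mem_univ l), add_sub_assoc]
    simp
  rw [hsplit]
  constructor
  · rw [natDegree_add_eq_left_of_degree_lt hrest]
    simp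
  · rw [leadingCoeff_add_of_degree_lt' hrest]
    simp

end ChebyshevSum

theorem prod_eval_eq_prod_roots {ι K : Type*} [Field K] [IsAlgClosed K] (p : K[X])
    (t : Finset ι) (x : ι → K) :
    ∏ i ∈ t, p.eval (x i) =
      p.leadingCoeff ^ #t * (p.roots.map fun w => ∏ i ∈ t, (x i - w)).prod := by
  simp_rw [(IsAlgClosed.splits p).eval_eq_prod_roots, prod_mul_distrib, prod_const,
    Multiset.prod_map_prod]

/-- the number of spanning trees of `C_n(s_1,…,s_k)` equals
`(-1)^{(n-1)(s_k-1)} · n · ∏_p (T_n(w_p) - 1)/(w_p - 1)`, the product being over the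
roots `w_p` (with multiplicity) of the degree `s_k - 1` polynomial
`P(w) = ∑_{j=1}^k (T_{s_j}(w) - 1)/(w - 1)`. -/
theorem statement6 (n k : ℕ) (hn : 2 ≤ n) (hk : 0 < k) (s : Fin k → ℕ)
    (hmono : StrictMono s) (h1 : ∀ j, 1 ≤ s j) (h2 : ∀ j, 2 * s j < n)
    (hgcd : Nat.gcd (Finset.univ.gcd s) n = 1) :
    (numSpanningTrees (circulant n s) : ℂ) =
      (-1) ^ ((n - 1) * (s ⟨k - 1, Nat.sub_lt hk Nat.one_pos⟩ - 1)) * n *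
        (((((∑ j : Fin k, (Polynomial.Chebyshev.T ℂ (s j) - 1)) /ₘ (X - C 1)).roots).map
          (fun w => ((Polynomial.Chebyshev.T ℂ n).eval w - 1) / (w - 1))).prod) := by
  have : NeZero n := ⟨by omega⟩
  set l : Fin k := ⟨k - 1, Nat.sub_lt hk Nat.one_pos⟩ with hl
  have hmax : ∀ j, j ≤ l := fun j => Fin.le_def.2 (Nat.le_sub_one_of_lt j.2)
  obtain ⟨hdeg, hlead⟩ := natDegree_and_leadingCoeff_sum_T_sub_one hmono h1 hmax
  have hmul := X_sub_one_mul_divByMonic_sum_T_sub_one s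
  have hne := eval_one_divByMonic_sum_T_sub_one_ne_zero hk h1
  have htau := mul_numSpanningTrees_circulant hmono.injective h1 h2
  rw [← hmul] at hdeg hlead
  set P := (∑ j : Fin k, (Polynomial.Chebyshev.T ℂ (s j) - 1)) /ₘ (X - C 1) with hP
  have hP0 : P ≠ 0 := by
    rintro h
    rw [h, eval_zero] at hne
    exact hne rfl
  rw [natDegree_mul (X_sub_C_ne_zero 1) hP0, natDegree_X_sub_C] at hdeg
  rw [leadingCoeff_mul, leadingCoeff_X_sub_C, one_mul] at hlead
  have hcard : P.roots.card = s l - 1 := by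
    rw [← (IsAlgClosed.splits P).natDegree_eq_card_roots]
    omega
  have hroots : (2 ^ (n - 1)) ^ (s l - 1) *
      (P.roots.map fun w => ∏ m ∈ univ.erase (0 : ZMod n), (zmodCos m - w)).prod =
      ((-1) ^ (n - 1)) ^ (s l - 1) *
        (P.roots.map fun w => ((Polynomial.Chebyshev.T ℂ n).eval w - 1) / (w - 1)).prod := by
    have h := congrArg Multiset.prod (Multiset.map_congr (s := P.roots) rfl fun w hw =>
      prod_erase_zmodCos_sub (n := n) (x := w) (by
        rintro rfl
        exact hne (isRoot_of_mem_roots hw)))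
    simpa only [Multiset.prod_map_mul, Multiset.map_const', Multiset.prod_replicate, hcard] using h
  have heig : ∀ m : ZMod n, circulantEigenvalue s m =
      (2 - 2 * zmodCos m) * eval (zmodCos m) P := by
    intro m
    rw [circulantEigenvalue, ← hmul, eval_mul, eval_sub, eval_X, eval_C]
    ring
  have hn0 : (n : ℂ) ≠ 0 := Nat.cast_ne_zero.2 (NeZero.ne n)
  apply mul_left_cancel₀ hn0
  rw [htau, prod_congr rfl fun m _ => heig m, prod_mul_distrib, prod_two_sub_zmodCos,
    prod_eval_eq_prod_roots, hlead, card_erase_of_mem (mem_univ _), card_univ, ZMod.card]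
  rw [← pow_mul, mul_comm (n - 1), pow_mul] at hroots
  rw [pow_mul, hroots]
  ring
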